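/- arXiv:2412.03881 — 2 statements merged into one kernel-verified Lean document; each statement's English description precedes it below -/
import Mathlib

section
/- Fix a label class i, parameters η ≥ 0, q ≥ 0, c > 0, and a class F of classifiers f : X → Y. Suppose the collection M'_η = { R_η(f) ∩ {x ∈ S_i^good ∩ D_overlap : f(x) = y(x)} : f ∈ F } satisfies (c,q,η)-robust expansion on (S_i^bad ∩ D_hard, S_i^good ∩ D_overlap). Then every classifier f ∈ F satisfying P(f(x) ≠ f_weak(x) or r(f,x) > η | S_i ∩ D_overlap) ≤ 1 − q − ε₁ obeys the error bound err(f, y | S_i ∩ D_hard) ≤ err(f, f_weak | S_i ∩ D_hard) + ε₂ − 2cε₂·(1 − err(f, f_weak | S_i^good ∩ D_overlap) − P(R_η(f)^c | S_i^good ∩ D_overlap)). -/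
/-!
Framework: finite probability space, neighborhoods, robust expansion
(following Lang et al. 2024), pseudolabelers and easy/hard/overlap partition.
-/

open Set

/-- Probability of a set `A` under a mass function `p` on a finite type. -/
noncomputable def pr {X : Type*} [Fintype X] (p : X → ℝ) (A : Set X) : ℝ :=
  ∑ x, A.indicator p x

/-- Conditional probability `P(A | B)`. -/
noncomputable def cpr {X : Type*} [Fintype X] (p : X → ℝ) (A B : Set X) : ℝ :=
  pr p (A ∩ B) / pr p B

/-- Neighborhood of a set: `N(A) = ⋃_{x ∈ A} N(x)`. -/
def nbhdSet {X : Type*} (N : X → Set X) (A : Set X) : Set X :=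
  ⋃ x ∈ A, N x

/-- Total edge weight between sets: `w(V,U) = ∑_{x ∈ V, x' ∈ U} P(x)P(x')𝟙[x ∈ N(x')]`. -/
noncomputable def wSet {X : Type*} [Fintype X] (p : X → ℝ) (N : X → Set X)
    (V U : Set X) : ℝ :=
  ∑ x, ∑ x', V.indicator p x * U.indicator p x' * (N x').indicator (fun _ => (1 : ℝ)) x

/-- Robustness `r(f,x) = P(f(x') ≠ f(x) | x' ∈ N(x))`. -/
noncomputable def rob {X Y : Type*} [Fintype X] (p : X → ℝ) (N : X → Set X)
    (f : X → Y) (x : X) : ℝ :=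
  cpr p {x' | f x' ≠ f x} (N x)

/-- The set of `η`-robust points `R_η(f)`. -/
def Reta {X Y : Type*} [Fintype X] (p : X → ℝ) (N : X → Set X) (η : ℝ)
    (f : X → Y) : Set X :=
  {x | rob p N f x ≤ η}

/-- `η`-robust neighborhood size
`P_{1-η}(U,A) = min { P(V|A) : w(V,U) ≥ (1-η) w(N(U),U) }`. -/
noncomputable def robNbhd {X : Type*} [Fintype X] (p : X → ℝ) (N : X → Set X)
    (η : ℝ) (U A : Set X) : ℝ :=
  sInf {r : ℝ | ∃ V : Set X,
    (1 - η) * wSet p N (nbhdSet N U) U ≤ wSet p N V U ∧ r = cpr p V A}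

/-- A collection `M` of subsets of `B` satisfies `(c,q,η)`-robust expansion on `(A,B)`. -/
def RobustExpansion {X : Type*} [Fintype X] (p : X → ℝ) (N : X → Set X)
    (c q η : ℝ) (M : Set (Set X)) (A B : Set X) : Prop :=
  ∀ U ∈ M, q < cpr p U B → c * cpr p U B < robNbhd p N η U A

section FiniteProbability

variable {X Y : Type*} [Fintype X] {p : X → ℝ}

theorem pr_nonneg (hp : ∀ x, 0 ≤ p x) (A : Set X) : 0 ≤ pr p A :=
  Finset.sum_nonneg fun x _ => indicator_nonneg (fun x _ => hp x) x

theorem pr_empty : pr p ∅ = 0 := by simp [pr]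

/-- A mass function is modular, hence monotone along simultaneous inclusions of unions and
intersections. -/
theorem pr_add_le_pr_add (hp : ∀ x, 0 ≤ p x) {A B C D : Set X}
    (hunion : A ∪ B ⊆ C ∪ D) (hinter : A ∩ B ⊆ C ∩ D) :
    pr p A + pr p B ≤ pr p C + pr p D := by
  classical
  simp only [pr, ← Finset.sum_add_distrib]
  refine Finset.sum_le_sum fun x _ => ?_
  have hu := @hunion x
  have hi := @hinter x
  have hx := hp x
  simp only [mem_union, mem_inter_iff] at hu hi
  by_cases hA : x ∈ A <;> by_cases hB : x ∈ B <;> by_cases hC : x ∈ C <;>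
    by_cases hD : x ∈ D <;> simp_all

theorem pr_mono (hp : ∀ x, 0 ≤ p x) {A B : Set X} (h : A ⊆ B) : pr p A ≤ pr p B := by
  simpa [pr_empty] using
    pr_add_le_pr_add hp (A := A) (B := ∅) (C := B) (D := ∅) (by simpa using h) (by simp)

theorem pr_union_le (hp : ∀ x, 0 ≤ p x) (A B : Set X) : pr p (A ∪ B) ≤ pr p A + pr p B := by
  simpa [pr_empty] using
    pr_add_le_pr_add hp (A := A ∪ B) (B := ∅) (C := A) (D := B) (by simp) (by simp)

theorem pr_inter_add_compl_inter (hp : ∀ x, 0 ≤ p x) (A B : Set X) :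
    pr p (A ∩ B) + pr p (Aᶜ ∩ B) = pr p B := by
  have hunion : A ∩ B ∪ Aᶜ ∩ B = B := by rw [← union_inter_distrib_right]; simp
  have hinter : A ∩ B ∩ (Aᶜ ∩ B) = ∅ := by ext x; simp; tauto
  refine le_antisymm ?_ ?_
  · simpa [pr_empty] using pr_add_le_pr_add hp (A := A ∩ B) (B := Aᶜ ∩ B) (C := B) (D := ∅)
      (by simp [hunion]) (by simp [hinter])
  · simpa [hunion] using pr_union_le hp (A ∩ B) (Aᶜ ∩ B)

theorem cpr_nonneg (hp : ∀ x, 0 ≤ p x) (A B : Set X) : 0 ≤ cpr p A B :=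
  div_nonneg (pr_nonneg hp _) (pr_nonneg hp _)

theorem cpr_mul_pr {A B : Set X} (hB : pr p B ≠ 0) : cpr p A B * pr p B = pr p (A ∩ B) :=
  div_mul_cancel₀ _ hB

theorem pr_pos_of_cpr_pos (hp : ∀ x, 0 ≤ p x) {A B : Set X} (h : 0 < cpr p A B) :
    0 < pr p B := by
  refine (pr_nonneg hp B).lt_of_ne fun h0 => ?_
  simp [cpr, ← h0] at h

theorem wSet_eq_sum_indicator_mul_pr (N : X → Set X) (V U : Set X) :
    wSet p N V U = ∑ x, U.indicator p x * pr p (V ∩ N x) := by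
  classical
  simp only [wSet, pr, Finset.mul_sum]
  rw [Finset.sum_comm]
  refine Finset.sum_congr rfl fun x _ => Finset.sum_congr rfl fun x' _ => ?_
  by_cases hV : x' ∈ V <;> by_cases hN : x' ∈ N x <;> simp [hV, hN, mul_comm]

/-- At a robust point the classifier keeps its value on all but an `η` fraction of the
neighborhood. -/
theorem one_sub_mul_pr_le_of_mem_Reta (hp : ∀ x, 0 ≤ p x) {N : X → Set X} {η : ℝ}
    {f : X → Y} {x : X} (hx : x ∈ Reta p N η f) :
    (1 - η) * pr p (N x) ≤ pr p ({x' | f x' = f x} ∩ N x) := by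
  have hsplit := pr_inter_add_compl_inter hp {x' | f x' = f x} (N x)
  rw [compl_ofPred] at hsplit
  rcases (pr_nonneg hp (N x)).eq_or_lt with h0 | hpos
  · rw [← h0, mul_zero]
    exact pr_nonneg hp _
  · have h : pr p ({x' | f x' ≠ f x} ∩ N x) ≤ η * pr p (N x) := (div_le_iff₀ hpos).1 hx
    change _ + pr p ({x' | f x' ≠ f x} ∩ N x) = _ at hsplit
    linarith

theorem robNbhd_le_cpr (hp : ∀ x, 0 ≤ p x) {N : X → Set X} {η : ℝ} {U V : Set X} (A : Set X)
    (hV : (1 - η) * wSet p N (nbhdSet N U) U ≤ wSet p N V U) :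
    robNbhd p N η U A ≤ cpr p V A := by
  refine csInf_le ⟨0, ?_⟩ ⟨V, hV, rfl⟩
  rintro _ ⟨W, -, rfl⟩
  exact cpr_nonneg hp W A

theorem robNbhd_le_cpr_of_robust (hp : ∀ x, 0 ≤ p x) {N : X → Set X} {η : ℝ} {f : X → Y}
    {i : Y} {U : Set X} (A : Set X) (hU : U ⊆ Reta p N η f) (hi : ∀ x ∈ U, f x = i) :
    robNbhd p N η U A ≤ cpr p {x | f x = i} A := by
  refine robNbhd_le_cpr hp A ?_
  rw [wSet_eq_sum_indicator_mul_pr, wSet_eq_sum_indicator_mul_pr, Finset.mul_sum]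
  refine Finset.sum_le_sum fun x _ => ?_
  by_cases hx : x ∈ U
  · have hN : nbhdSet N U ∩ N x = N x :=
      inter_eq_right.2 (subset_biUnion_of_mem (u := N) hx)
    have h := one_sub_mul_pr_le_of_mem_Reta hp (hU hx)
    rw [hi x hx] at h
    rw [hN, indicator_of_mem hx, mul_left_comm]
    exact mul_le_mul_of_nonneg_left h (hp x)
  · simp [hx]

end FiniteProbability

theorem pseudolabel_correction
    {X Y : Type*} [Fintype X]
    (p : X → ℝ) (hp0 : ∀ x, 0 ≤ p x) (hp1 : ∑ x, p x = 1)
    (N : X → Set X) (hNsymm : ∀ x x', x ∈ N x' ↔ x' ∈ N x)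
    (y : X → Y) (fw : X → Option Y)
    (Deasy Dhard Dover : Set X)
    (hcover : Deasy ∪ Dhard ∪ Dover = Set.univ)
    (hdis1 : Disjoint Deasy Dhard) (hdis2 : Disjoint Deasy Dover)
    (hdis3 : Disjoint Dhard Dover)
    (i : Y)
    (S Si Sgood Sbad : Set X)
    (hS : S = {x | fw x ≠ none})
    (hSi : Si = {x ∈ S | y x = i})
    (hSgood : Sgood = {x ∈ Si | fw x = some (y x)})
    (hSbad : Sbad = Si \ Sgood)
    (ε₁ ε₂ : ℝ)
    (hε₁ : ε₁ = cpr p {x | fw x ≠ some (y x)} (Si ∩ Dover))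
    (hε₁' : ε₁ = cpr p {x | fw x ≠ some (y x)} (Si ∩ Deasy))
    (hε₂ : ε₂ = cpr p {x | fw x ≠ some (y x)} (Si ∩ Dhard))
    (hε₁pos : 0 < ε₁) (hε₁₂ : ε₁ ≤ ε₂) (hε₂half : ε₂ ≤ 1 / 2)
    (η q c : ℝ) (hη : 0 ≤ η) (hq : 0 ≤ q) (hc : 0 < c)
    (F : Set (X → Y))
    (hexp : RobustExpansion p N c q η
      ((fun f => Reta p N η f ∩ {x ∈ Sgood ∩ Dover | f x = y x}) '' F)
      (Sbad ∩ Dhard) (Sgood ∩ Dover))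
    (f : X → Y) (hfF : f ∈ F)
    (hf : cpr p {x | some (f x) ≠ fw x ∨ η < rob p N f x} (Si ∩ Dover)
      ≤ 1 - q - ε₁) :
    cpr p {x | f x ≠ y x} (Si ∩ Dhard)
      ≤ cpr p {x | some (f x) ≠ fw x} (Si ∩ Dhard) + ε₂
        - 2 * c * ε₂ *
          (1 - cpr p {x | some (f x) ≠ fw x} (Sgood ∩ Dover)
            - cpr p (Reta p N η f)ᶜ (Sgood ∩ Dover)) := by
  subst hS hSi hSgood hSbad
  set Si : Set X := {x ∈ {x | fw x ≠ none} | y x = i} with hSi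
  set Sgood : Set X := {x ∈ Si | fw x = some (y x)} with hSgood
  set A := (Si \ Sgood) ∩ Dhard with hA
  set B := Sgood ∩ Dover with hB
  set U := Reta p N η f ∩ {x ∈ B | f x = y x} with hU
  have hUB : U ∩ B = U := inter_eq_left.2 fun x hx => hx.2.1
  have hrob : robNbhd p N η U A ≤ cpr p {x | f x = i} A :=
    robNbhd_le_cpr_of_robust hp0 A inter_subset_left
      fun x hx => hx.2.2.trans hx.2.1.1.1.2
  have hOver : 0 < pr p (Si ∩ Dover) := pr_pos_of_cpr_pos hp0 (hε₁ ▸ hε₁pos)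
  have hHard : 0 < pr p (Si ∩ Dhard) :=
    pr_pos_of_cpr_pos hp0 (hε₂ ▸ hε₁pos.trans_le hε₁₂)
  have hbadOver : ε₁ * pr p (Si ∩ Dover) = pr p ({x | fw x ≠ some (y x)} ∩ (Si ∩ Dover)) := by
    rw [hε₁, cpr_mul_pr hOver.ne']
  have hprA : ε₂ * pr p (Si ∩ Dhard) = pr p A := by
    rw [hε₂, cpr_mul_pr hHard.ne']
    congr 1
    ext x
    simp only [hA, hSgood, mem_inter_iff, mem_sdiff, mem_ofPred_eq]
    tauto
  have hprB : pr p B = (1 - ε₁) * pr p (Si ∩ Dover) := by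
    have h := pr_inter_add_compl_inter hp0 {x | fw x ≠ some (y x)} (Si ∩ Dover)
    have hset : {x | fw x ≠ some (y x)}ᶜ ∩ (Si ∩ Dover) = B := by
      ext x
      simp only [hB, hSgood, mem_inter_iff, mem_compl_iff, mem_ofPred_eq]
      tauto
    rw [hset, ← hbadOver] at h
    linarith
  have hBpos : 0 < pr p B := hprB ▸ mul_pos (by linarith) hOver
  have hApos : 0 < pr p A := hprA ▸ mul_pos (by linarith) hHard
  -- The robust, correctly labelled part of the overlap has conditional mass at least `q`.
  have hqU : q * pr p (Si ∩ Dover) ≤ pr p U := by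
    have hmis := (div_le_iff₀ hOver).1 hf
    have hcov : Si ∩ Dover ⊆ {x | some (f x) ≠ fw x ∨ η < rob p N f x} ∩ (Si ∩ Dover) ∪
        ({x | fw x ≠ some (y x)} ∩ (Si ∩ Dover) ∪ U) := by
      intro x hx
      by_cases h1 : some (f x) ≠ fw x ∨ η < rob p N f x
      · exact Or.inl ⟨h1, hx⟩
      by_cases h2 : fw x ≠ some (y x)
      · exact Or.inr (Or.inl ⟨h2, hx⟩)
      push Not at h1 h2
      exact Or.inr (Or.inr ⟨h1.2, ⟨⟨hx.1, h2⟩, hx.2⟩, Option.some.inj (h1.1.trans h2)⟩)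
    have h := (pr_mono hp0 hcov).trans
      ((pr_union_le hp0 _ _).trans (add_le_add_right (pr_union_le hp0 _ _) _))
    linarith
  have hcU : c * cpr p U B ≤ cpr p {x | f x = i} A := by
    by_cases hlt : q < cpr p U B
    · exact (hexp U ⟨f, hfF, rfl⟩ hlt).le.trans hrob
    · have hle : pr p U ≤ q * pr p B := by
        have := (div_le_iff₀ hBpos).1 (not_lt.1 hlt)
        rwa [hUB] at this
      rw [hprB] at hle
      have hq0 : q = 0 := by
        have hpos := mul_pos hε₁pos hOver
        nlinarith
      have hneg : cpr p U B ≤ 0 := hq0 ▸ not_lt.1 hlt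
      exact (mul_nonpos_of_nonneg_of_nonpos hc.le hneg).trans (cpr_nonneg hp0 _ _)
  have hUlower : 1 - cpr p {x | some (f x) ≠ fw x} B - cpr p (Reta p N η f)ᶜ B ≤ cpr p U B := by
    have hcov : B ⊆ {x | some (f x) ≠ fw x} ∩ B ∪ ((Reta p N η f)ᶜ ∩ B ∪ U) := by
      intro x hx
      by_cases h1 : some (f x) ≠ fw x
      · exact Or.inl ⟨h1, hx⟩
      by_cases h2 : x ∈ Reta p N η f
      · exact Or.inr (Or.inr ⟨h2, hx, Option.some.inj ((not_not.1 h1).trans hx.1.2)⟩)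
      · exact Or.inr (Or.inl ⟨h2, hx⟩)
    have h := (pr_mono hp0 hcov).trans
      ((pr_union_le hp0 _ _).trans (add_le_add_right (pr_union_le hp0 _ _) _))
    rw [← cpr_mul_pr hBpos.ne', ← cpr_mul_pr hBpos.ne', ← hUB, ← cpr_mul_pr hBpos.ne'] at h
    refine le_of_mul_le_mul_right ?_ hBpos
    linarith
  -- Passing from `fw` to `y` on the hard part only changes the count on mislabelled points.
  have hswap : pr p ({x | f x ≠ y x} ∩ (Si ∩ Dhard)) + pr p ({x | f x = i} ∩ A) ≤
      pr p ({x | some (f x) ≠ fw x} ∩ (Si ∩ Dhard)) + pr p ({x | f x = i}ᶜ ∩ A) := by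
    refine pr_add_le_pr_add hp0 ?_ ?_
    · rintro x (⟨hne, hx⟩ | ⟨heq, hx⟩)
      · by_cases hgood : fw x = some (y x)
        · exact Or.inl ⟨fun h => hne (Option.some.inj (h.trans hgood)), hx⟩
        · exact Or.inr ⟨fun h => hne (h.trans hx.1.2.symm), ⟨hx.1, fun h => hgood h.2⟩, hx.2⟩
      · refine Or.inl ⟨fun h => hx.1.2 ⟨hx.1.1, ?_⟩, hx.1.1, hx.2⟩
        rw [← h, hx.1.1.2]
        exact congrArg some heq
    · rintro x ⟨⟨hne, -⟩, heq, hx⟩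
      exact absurd (Eq.trans heq hx.1.1.2.symm) hne
  have hsplit := pr_inter_add_compl_inter hp0 {x | f x = i} A
  have hkey : c * (1 - cpr p {x | some (f x) ≠ fw x} B - cpr p (Reta p N η f)ᶜ B) * pr p A ≤
      pr p ({x | f x = i} ∩ A) := by
    rw [← cpr_mul_pr hApos.ne']
    exact mul_le_mul_of_nonneg_right
      ((mul_le_mul_of_nonneg_left hUlower hc.le).trans hcU) hApos.le
  rw [← cpr_mul_pr hHard.ne', ← cpr_mul_pr hHard.ne' (A := {x | some (f x) ≠ fw x})] at hswap
  refine le_of_mul_le_mul_right ?_ hHard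
  rw [← hprA] at hkey hsplit
  linarith
end

section
/- Let Z₁ and Z₂ be independent standard normal random variables. Then for every real a with |a| < 1/2, E[exp(a·Z₁Z₂)] ≤ exp( (2/3)·a² ). -/
open MeasureTheory ProbabilityTheory

/-- Exponential moment of the square of a standard Gaussian variable. -/
lemma integral_exp_mul_sq_gaussianReal {s : ℝ} (hs : s < 1 / 2) :
    ∫ x, Real.exp (s * x ^ 2) ∂(gaussianReal 0 1) = √((1 - 2 * s)⁻¹) := by
  rw [integral_gaussianReal_eq_integral_smul one_ne_zero]
  have h : ∀ x : ℝ, gaussianPDFReal 0 1 x • Real.exp (s * x ^ 2)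
      = (√(2 * Real.pi))⁻¹ * Real.exp (-(1 / 2 - s) * x ^ 2) := by
    intro x
    rw [gaussianPDFReal, smul_eq_mul, mul_assoc, ← Real.exp_add]
    simp only [NNReal.coe_one, mul_one, sub_zero]
    ring_nf
  simp_rw [h]
  rw [integral_const_mul, integral_gaussian, ← Real.sqrt_inv, ← Real.sqrt_mul (by positivity)]
  congr 1
  have h1 : (1 : ℝ) - 2 * s ≠ 0 := by linarith
  have h2 : (1 : ℝ) / 2 - s ≠ 0 := by linarith
  field_simp

lemma inv_one_sub_le_exp {u : ℝ} (h0 : 0 ≤ u) (h1 : u ≤ 1 / 4) :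
    (1 - u)⁻¹ ≤ Real.exp (4 / 3 * u) := by
  refine le_trans ?_ (Real.add_one_le_exp _)
  rw [inv_le_iff_one_le_mul₀ (by linarith)]
  nlinarith [mul_nonneg h0 (sub_nonneg.2 h1)]

theorem mgf_product_std_gaussians_bound
    {Ω : Type*} [MeasureSpace Ω] [IsProbabilityMeasure (ℙ : Measure Ω)]
    (Z₁ Z₂ : Ω → ℝ)
    (hZ₁ : Measure.map Z₁ ℙ = gaussianReal 0 1)
    (hZ₂ : Measure.map Z₂ ℙ = gaussianReal 0 1)
    (hindep : IndepFun Z₁ Z₂ ℙ) :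
    ∀ a : ℝ, |a| < 1 / 2 →
      ∫ ω, Real.exp (a * (Z₁ ω * Z₂ ω)) ∂ℙ ≤ Real.exp ((2 / 3) * a ^ 2) := by
  intro a ha
  have hm₁ : AEMeasurable Z₁ ℙ := by
    refine AEMeasurable.of_map_ne_zero ?_
    rw [hZ₁]
    exact IsProbabilityMeasure.ne_zero _
  have hm₂ : AEMeasurable Z₂ ℙ := by
    refine AEMeasurable.of_map_ne_zero ?_
    rw [hZ₂]
    exact IsProbabilityMeasure.ne_zero _
  have hsq : a ^ 2 ≤ 1 / 4 := by
    have := sq_le_sq' (by linarith [abs_lt.1 ha]) (abs_lt.1 ha).2.le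
    linarith
  have hprod : ∫ ω, Real.exp (a * (Z₁ ω * Z₂ ω)) ∂ℙ
      = ∫ p, Real.exp (a * (p.1 * p.2)) ∂((gaussianReal 0 1).prod (gaussianReal 0 1)) := by
    have hmap := hindep.map_prod_eq_prod_map_map hm₁ hm₂
    rw [hZ₁, hZ₂] at hmap
    rw [← hmap, integral_map (hm₁.prodMk hm₂)
      (Measurable.aestronglyMeasurable (by fun_prop))]
  rw [hprod]
  by_cases hint : Integrable (fun p : ℝ × ℝ ↦ Real.exp (a * (p.1 * p.2)))
      ((gaussianReal 0 1).prod (gaussianReal 0 1))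
  · have hinner : ∀ x : ℝ, ∫ y, Real.exp (a * (x * y)) ∂(gaussianReal 0 1)
        = Real.exp (a ^ 2 / 2 * x ^ 2) := by
      intro x
      have h := congrFun (mgf_id_gaussianReal (μ := 0) (v := 1)) (a * x)
      simp only [mgf, id_eq, zero_mul, zero_add, NNReal.coe_one, one_mul] at h
      simp_rw [← mul_assoc a]
      rw [h]
      ring_nf
    rw [integral_prod _ hint]
    simp_rw [hinner]
    rw [integral_exp_mul_sq_gaussianReal (by linarith), Real.sqrt_le_left (Real.exp_pos _).le,
      ← Real.exp_nat_mul, mul_div_cancel₀ _ two_ne_zero]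
    convert inv_one_sub_le_exp (sq_nonneg a) hsq using 2
    push_cast
    ring
  · rw [integral_undef hint]
    positivity
end
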